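/- arXiv:1111.1548 — 4 statements merged into one kernel-verified Lean document; each statement's English description precedes it below -/
import Mathlib

section
/- Finiteness of fixed points for p-adically expansive systems (part of Theorem 14): Let Γ be a group, p a prime number, and f ∈ ℤΓ, and suppose there exist i₀ ≥ 0 and h, q ∈ ℤΓ with p^{i₀} = p^{i₀+1}·h + q·f in ℤΓ (i.e. the Γ-action on X_f is p-adically expansive). Then for every normal subgroup N of Γ of finite index, the quotient module ℤ[Γ/N]/ℤ[Γ/N]·f̄ is a finite set, where f̄ denotes the image of f under the ring homomorphism ℤΓ → ℤ[Γ/N] induced by the projection Γ → Γ/N. -/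
theorem aux_group {R M : Type*} [AddCommGroup R] [AddCommGroup M] [Module.Finite ℤ R]
    (p : ℕ) (hp : p.Prime) (i : ℕ) (π : R →+ M) (hπ : Function.Surjective π)
    (key : ∀ r : R, ∃ s : R, ((p : ℤ) ^ i) • π r = (p : ℤ) • ((p : ℤ) ^ i) • π s) :
    Finite M := by
  have hfin : Module.Finite ℤ M := Module.Finite.of_surjective π.toIntLinearMap hπ
  let P : Submodule ℤ M :=
    LinearMap.range (LinearMap.lsmul ℤ M ((p : ℤ) ^ i))
  obtain ⟨n, hn, hn0⟩ := Submodule.exists_sub_one_mem_and_smul_eq_zero_of_fg_of_le_smul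
    (Ideal.span {(p : ℤ)}) P (IsNoetherian.noetherian P) (by
      rintro _ ⟨x, rfl⟩
      obtain ⟨r, rfl⟩ := hπ x
      obtain ⟨s, hs⟩ := key r
      rw [LinearMap.lsmul_apply, hs]
      exact Submodule.smul_mem_smul (Ideal.mem_span_singleton_self _) ⟨π s, rfl⟩)
  have hn' : n ≠ 0 := by
    rintro rfl
    rw [Ideal.mem_span_singleton] at hn
    have h1 : (p : ℤ) ∣ 1 := by simpa using hn
    have h2 : p ∣ 1 := by exact_mod_cast h1
    exact hp.one_lt.ne' (Nat.dvd_one.mp h2)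
  refine Module.finite_of_fg_torsion _ ?_
  intro x
  have hne : n * (p : ℤ) ^ i ≠ 0 :=
    mul_ne_zero hn' (pow_ne_zero _ (by exact_mod_cast hp.ne_zero))
  refine ⟨⟨n * (p : ℤ) ^ i, mem_nonZeroDivisors_of_ne_zero hne⟩, ?_⟩
  change (n * (p : ℤ) ^ i) • x = 0
  rw [mul_smul]
  exact hn0 _ ⟨x, rfl⟩

theorem aux_finite {R : Type*} [Ring R] [Module.Finite ℤ R] (p : ℕ) (hp : p.Prime) (f h q : R)
    (i : ℕ) (e : (p : R) ^ i = (p : R) ^ (i + 1) * h + q * f) :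
    Finite (R ⧸ Submodule.span R {f}) := by
  refine aux_group p hp i (Submodule.mkQ (Submodule.span R {f})).toAddMonoidHom
    (Submodule.mkQ_surjective _) ?_
  intro r
  refine ⟨r * h, ?_⟩
  rw [smul_smul, ← map_zsmul, ← map_zsmul, ← sub_eq_zero, ← map_sub]
  refine (Submodule.Quotient.mk_eq_zero _).2 ?_
  rw [Submodule.mem_span_singleton]
  refine ⟨r * q, ?_⟩
  have e2 := congrArg (fun x => r * x) e
  simp only [mul_add] at e2
  have c : r * (p : R) ^ i = (p : R) ^ i * r := ((Nat.cast_commute p r).pow_left i).eq.symm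
  have c' : r * (p : R) ^ (i + 1) = (p : R) ^ (i + 1) * r :=
    ((Nat.cast_commute p r).pow_left (i + 1)).eq.symm
  rw [← mul_assoc, c, c'] at e2
  simp only [zsmul_eq_mul, smul_eq_mul, ← pow_succ']
  push_cast
  rw [e2, mul_assoc, mul_assoc, add_sub_cancel_left]

/-- Finiteness of fixed points for `p`-adically expansive systems (part of Theorem 14):
if `p^{i₀} = p^{i₀+1}·h + q·f` in `ℤΓ` for some `i₀, h, q`, then for every normal
subgroup `N` of finite index the quotient `ℤ[Γ/N]/ℤ[Γ/N]·f̄` is finite. -/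
theorem fix_finite_of_padic_expansive {Γ : Type*} [Group Γ] (p : ℕ) (hp : p.Prime)
    (f : MonoidAlgebra ℤ Γ)
    (hexp : ∃ i₀ : ℕ, ∃ h q : MonoidAlgebra ℤ Γ,
        (p : MonoidAlgebra ℤ Γ) ^ i₀ = (p : MonoidAlgebra ℤ Γ) ^ (i₀ + 1) * h + q * f)
    (N : Subgroup Γ) [N.Normal] [Finite (Γ ⧸ N)] :
    Finite ((MonoidAlgebra ℤ (Γ ⧸ N)) ⧸
      Submodule.span (MonoidAlgebra ℤ (Γ ⧸ N))
        {MonoidAlgebra.mapDomainRingHom ℤ (QuotientGroup.mk' N) f}) := by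
  obtain ⟨i, h, q, e⟩ := hexp
  have e' := congrArg (MonoidAlgebra.mapDomainRingHom ℤ (QuotientGroup.mk' N)) e
  simp only [map_add, map_mul, map_pow, map_natCast] at e'
  exact aux_finite p hp _ _ _ i e'
end

section
/- Proposition 17: Let Γ be a group, p a prime number, R = ℤΓ the integral group ring, and M an R-module which is Noetherian as an R-module. Suppose there exists i₀ ≥ 0 such that p^{i₀}M = p^{i}M for all i ≥ i₀ (as submodules of M; this is equivalent to the Pontryagin dual X = M̂ having bounded p-torsion). Then M is a torsion ℤΓ-module: for every m ∈ M there exists a nonzero r ∈ ℤΓ with r·m = 0. -/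
/-- Proposition 17: if `M` is a Noetherian module over `ℤΓ` such that the chain of
submodules `p^i M` (the image of `M` under multiplication by `p^i`) becomes stationary
(i.e. the Pontryagin dual of `M` has bounded `p`-torsion), then `M` is a torsion
`ℤΓ`-module. -/
theorem torsion_of_bounded_p_torsion {Γ : Type*} [Group Γ] (p : ℕ) (hp : p.Prime)
    (M : Type*) [AddCommGroup M] [Module (MonoidAlgebra ℤ Γ) M]
    [IsNoetherian (MonoidAlgebra ℤ Γ) M]
    (hstat : ∃ i₀ : ℕ, ∀ i ≥ i₀,
        Submodule.map ((p ^ i₀ : ℤ) • (LinearMap.id : M →ₗ[MonoidAlgebra ℤ Γ] M))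
            (⊤ : Submodule (MonoidAlgebra ℤ Γ) M) =
          Submodule.map ((p ^ i : ℤ) • (LinearMap.id : M →ₗ[MonoidAlgebra ℤ Γ] M))
            (⊤ : Submodule (MonoidAlgebra ℤ Γ) M)) :
    ∀ m : M, ∃ r : MonoidAlgebra ℤ Γ, r ≠ 0 ∧ r • m = 0 := by
  obtain ⟨i₀, h⟩ := hstat
  intro m
  have hf : ∀ y : M, ∃ z : M, ((p : ℤ) ^ i₀) • y = ((p : ℤ) ^ (i₀ + 1)) • z := by
    intro y
    have hy : ((p : ℤ) ^ i₀) • y ∈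
        Submodule.map ((p ^ i₀ : ℤ) • (LinearMap.id : M →ₗ[MonoidAlgebra ℤ Γ] M))
            (⊤ : Submodule (MonoidAlgebra ℤ Γ) M) := ⟨y, trivial, rfl⟩
    rw [h (i₀ + 1) (Nat.le_succ _)] at hy
    obtain ⟨z, -, hz⟩ := hy
    exact ⟨z, hz.symm⟩
  choose f hf using hf
  let x : ℕ → M := fun k => ((p : ℤ) ^ i₀) • (f^[k] m)
  have hx : ∀ k, x k = (p : ℤ) • x (k + 1) := by
    intro k
    simp only [x, Function.iterate_succ_apply', smul_smul]
    rw [hf, pow_succ']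
  have hx0 : ∀ k, x 0 = ((p : ℤ) ^ k) • x k := by
    intro k
    induction k with
    | zero => simp
    | succ k ih => rw [ih, hx k, smul_smul, pow_succ]
  let F : ℕ →o Submodule (MonoidAlgebra ℤ Γ) M :=
    ⟨fun k => Submodule.span _ {x k}, monotone_nat_of_le_succ (by
      intro k
      rw [Submodule.span_singleton_le_iff_mem, hx k]
      exact zsmul_mem (Submodule.mem_span_singleton_self _) _)⟩
  obtain ⟨n, hn⟩ := monotone_stabilizes_iff_noetherian.mpr
    (inferInstance : IsNoetherian (MonoidAlgebra ℤ Γ) M) F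
  have hmem : x (n + 1) ∈ F n := by
    rw [hn (n + 1) (Nat.le_succ _)]
    exact Submodule.mem_span_singleton_self _
  obtain ⟨r, hr⟩ := Submodule.mem_span_singleton.mp hmem
  have key : x 0 = (p : ℤ) • r • x 0 := by
    conv_lhs => rw [hx0 (n + 1), ← hr]
    rw [hx0 n, smul_comm r ((p : ℤ) ^ n) (x n), smul_smul, pow_succ']
  refine ⟨((p : ℤ) ^ i₀) • (1 - (p : ℤ) • r), ?_, ?_⟩
  · have hp0 : ((p : ℤ) ^ i₀) ≠ 0 := pow_ne_zero _ (by exact_mod_cast hp.ne_zero)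
    intro h0
    have h1 := congrArg (fun a : MonoidAlgebra ℤ Γ => a.coeff 1) h0
    simp [MonoidAlgebra.one_def, hp.ne_zero, -zsmul_eq_mul, -natCast_zsmul] at h1
    have h2 : (p : ℤ) ∣ 1 := ⟨r.coeff 1, by linarith [h1]⟩
    exact hp.one_lt.ne' (by exact_mod_cast Int.eq_one_of_dvd_one (by positivity) h2)
  · have : x 0 = ((p : ℤ) ^ i₀) • m := rfl
    rw [smul_assoc, ← smul_comm (1 - (p : ℤ) • r) ((p : ℤ) ^ i₀) m, ← this, sub_smul, one_smul,
      smul_assoc, ← key, sub_self]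
end

section
/- Group algebras of residually finite groups are Dedekind-finite: Let Γ be a group such that for every γ ∈ Γ with γ ≠ e there exists a normal subgroup N of Γ of finite index with γ ∉ N, and let K be a field. If f, g ∈ K[Γ] satisfy f·g = 1 in the group algebra K[Γ], then also g·f = 1. -/
/-- Group algebras of residually finite groups are Dedekind-finite: if every nontrivial
element of `Γ` avoids some finite-index normal subgroup, then `f·g = 1` in `K[Γ]`
implies `g·f = 1`. -/
theorem groupAlgebra_dedekind_finite_of_residually_finite {Γ K : Type*} [Group Γ] [Field K]
    (hrf : ∀ γ : Γ, γ ≠ 1 → ∃ N : Subgroup Γ, N.Normal ∧ N.FiniteIndex ∧ γ ∉ N)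
    (f g : MonoidAlgebra K Γ) (h : f * g = 1) : g * f = 1 := by
  have hrf' : ∀ γ : Γ, ∃ N : Subgroup Γ, N.Normal ∧ N.FiniteIndex ∧ (γ ≠ 1 → γ ∉ N) := by
    intro γ
    by_cases hγ : γ = 1
    · exact ⟨⊤, inferInstance, inferInstance, fun h => absurd hγ h⟩
    · obtain ⟨N, h1, h2, h3⟩ := hrf γ hγ
      exact ⟨N, h1, h2, fun _ => h3⟩
  choose N hN hF hmem using hrf'
  rw [← sub_eq_zero]
  set x := g * f - 1 with hx
  let S := x.coeff.support
  let M : Subgroup Γ := ⨅ p : S × S, N ((p.1 : Γ)⁻¹ * p.2)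
  have hMn : M.Normal := Subgroup.normal_iInf_normal fun p => hN _
  have hMf : M.FiniteIndex := Subgroup.finiteIndex_iInf fun p => hF _
  have hinj : Set.InjOn (QuotientGroup.mk' M) (S : Set Γ) := by
    intro a ha b hb hab
    have h1 : a⁻¹ * b ∈ M := QuotientGroup.eq.1 hab
    have h2 : a⁻¹ * b ∈ N (a⁻¹ * b) := (Subgroup.mem_iInf.1 h1) (⟨a, ha⟩, ⟨b, hb⟩)
    by_contra hne
    exact hmem _ (fun h => hne (inv_mul_eq_one.1 h)) h2
  let φ := MonoidAlgebra.mapDomainRingHom K (QuotientGroup.mk' M)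
  have : Finite (Γ ⧸ M) := inferInstance
  have : Module.Finite K (MonoidAlgebra K (Γ ⧸ M)) := inferInstance
  have : IsNoetherianRing (MonoidAlgebra K (Γ ⧸ M)) := IsNoetherianRing.of_finite K _
  have h1 : φ f * φ g = 1 := by rw [← map_mul, h, map_one]
  have h2 : φ g * φ f = 1 := mul_eq_one_symm h1
  have h3 : φ x = 0 := by rw [hx, map_sub, map_mul, h2, map_one, sub_self]
  have h4 : Finsupp.mapDomain (QuotientGroup.mk' M) x.coeff = 0 := congrArg MonoidAlgebra.coeff h3
  ext a
  by_contra hne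
  have ha : a ∈ S := Finsupp.mem_support_iff.2 hne
  have h5 := Finsupp.mapDomain_apply' (S : Set Γ) x.coeff (subset_refl _) hinj ha
  rw [h4] at h5
  exact hne h5.symm
end

section
/- Additivity of the trace of the p-adic logarithm on 1-units of matrix algebras over ℤ_p (case Γ trivial of the homomorphism property of log_p det, equation (17)): Let p be a prime number, n ≥ 1, and let u, v be n×n matrices over ℚ_p such that every entry of u − 1 and of v − 1 has p-adic norm ≤ 1/p. Define log w = − Σ_{ν=1}^{∞} (1 − w)^{ν}/ν, a convergent series in the n×n matrices over ℚ_p. Then trace(log(u·v)) = trace(log u) + trace(log v), and moreover |trace(log u)|_p ≤ 1, i.e. trace(log u) ∈ ℤ_p. -/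
/-- The `p`-adic logarithm `log w = − Σ_{ν≥1} (1−w)^ν/ν` of a matrix `w` over `ℚ_p`
(the `ν = 0` term vanishes since `(0 : ℚ_p)⁻¹ = 0`). -/
noncomputable def matLog {p : ℕ} [Fact p.Prime] {n : ℕ}
    (w : Matrix (Fin n) (Fin n) ℚ_[p]) : Matrix (Fin n) (Fin n) ℚ_[p] :=
  - ∑' ν : ℕ, ((ν : ℚ_[p]))⁻¹ • (1 - w) ^ ν

open Filter Topology

namespace TML

variable {p : ℕ} [hp : Fact p.Prime]

lemma norm_nat_le (m : ℕ) : ‖(m : ℚ_[p])‖ ≤ 1 := by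
  have := Padic.norm_int_le_one (p := p) (m : ℤ)
  simpa using this

lemma norm_inv_nat_le (m : ℕ) : ‖((m : ℚ_[p]))⁻¹‖ ≤ m := by
  rcases Nat.eq_zero_or_pos m with rfl | hm
  · simp
  have h0 : (m : ℚ_[p]) ≠ 0 := by exact_mod_cast hm.ne'
  rw [norm_inv, Padic.norm_eq_zpow_neg_valuation h0, Padic.valuation_natCast, zpow_neg, inv_inv,
    zpow_natCast]
  exact_mod_cast Nat.le_of_dvd hm pow_padicValNat_dvd

/-- The binomial coefficient `C(p^k, m)/p^k`, with the `m = 0` term dropped. -/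
noncomputable def c (p : ℕ) [Fact p.Prime] (k m : ℕ) : ℚ_[p] :=
  if m = 0 then 0 else ((p ^ k).choose m : ℚ_[p]) / (p : ℚ_[p]) ^ k

lemma p_ne : (p : ℚ_[p]) ≠ 0 := by exact_mod_cast hp.out.ne_zero

lemma c_succ (k m : ℕ) :
    c p k (m + 1) = ((p ^ k - 1).choose m : ℚ_[p]) * ((m + 1 : ℕ) : ℚ_[p])⁻¹ := by
  have hq : 0 < p ^ k := pow_pos hp.out.pos k
  have h := Nat.add_one_mul_choose_eq (p ^ k - 1) m
  rw [Nat.sub_add_cancel hq] at h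
  have h' : (p : ℚ_[p]) ^ k * ((p ^ k - 1).choose m : ℚ_[p])
      = ((p ^ k).choose (m + 1) : ℚ_[p]) * ((m + 1 : ℕ) : ℚ_[p]) := by exact_mod_cast h
  have h1 : (p : ℚ_[p]) ^ k ≠ 0 := pow_ne_zero _ p_ne
  have h2 : ((m + 1 : ℕ) : ℚ_[p]) ≠ 0 := by exact_mod_cast m.succ_ne_zero
  unfold c
  rw [if_neg (Nat.succ_ne_zero m), ← div_eq_mul_inv, div_eq_div_iff h1 h2, ← h', mul_comm]

lemma norm_c_le (k m : ℕ) : ‖c p k m‖ ≤ m := by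
  cases m with
  | zero => simp [c]
  | succ m =>
    rw [c_succ, norm_mul]
    calc _ ≤ 1 * ((m + 1 : ℕ) : ℝ) :=
          mul_le_mul (norm_nat_le _) (norm_inv_nat_le _) (norm_nonneg _) zero_le_one
      _ = _ := one_mul _

lemma tendsto_q : Tendsto (fun k : ℕ => (p : ℚ_[p]) ^ k) atTop (𝓝 0) :=
  tendsto_pow_atTop_nhds_zero_of_norm_lt_one Padic.norm_p_lt_one

lemma tendsto_choose (m : ℕ) :
    Tendsto (fun k : ℕ => ((p ^ k - 1).choose m : ℚ_[p])) atTop (𝓝 ((-1) ^ m)) := by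
  induction m with
  | zero => simp
  | succ m ih =>
    have h1 : ∀ k, ((p ^ k - 1).choose (m + 1) : ℚ_[p]) =
        (p : ℚ_[p]) ^ k * (((p ^ k - 1).choose m : ℚ_[p]) * ((m + 1 : ℕ) : ℚ_[p])⁻¹)
          - ((p ^ k - 1).choose m : ℚ_[p]) := by
      intro k
      have hq : 0 < p ^ k := pow_pos hp.out.pos k
      have h := Nat.choose_succ_succ (p ^ k - 1) m
      rw [Nat.succ_eq_add_one, Nat.sub_add_cancel hq] at h
      have h' : ((p ^ k).choose (m + 1) : ℚ_[p]) = ((p ^ k - 1).choose m : ℚ_[p])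
        + ((p ^ k - 1).choose (m + 1) : ℚ_[p]) := by exact_mod_cast h
      rw [← c_succ, c, if_neg (Nat.succ_ne_zero m), mul_div_cancel₀ _ (pow_ne_zero _ p_ne), h']
      ring
    simp_rw [h1]
    have := (tendsto_q (p := p)).mul (ih.mul_const (((m + 1 : ℕ) : ℚ_[p])⁻¹)) |>.sub ih
    convert this using 2
    ring

lemma tendsto_c (m : ℕ) :
    Tendsto (fun k : ℕ => c p k m) atTop (𝓝 (-((-1) ^ m * (m : ℚ_[p])⁻¹))) := by
  cases m with
  | zero => simp [c]
  | succ m =>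
    simp_rw [c_succ]
    convert (tendsto_choose (p := p) m).mul_const (((m + 1 : ℕ) : ℚ_[p])⁻¹) using 2
    ring

variable {n : ℕ}

lemma norm_mul_le {a b : Matrix (Fin n) (Fin n) ℚ_[p]} {r s : ℝ} (hr : 0 ≤ r) (hs : 0 ≤ s)
    (ha : ∀ i j, ‖a i j‖ ≤ r) (hb : ∀ i j, ‖b i j‖ ≤ s) (i j : Fin n) :
    ‖(a * b) i j‖ ≤ r * s := by
  rw [Matrix.mul_apply]
  refine IsUltrametricDist.norm_sum_le_of_forall_le_of_nonneg (mul_nonneg hr hs) fun l _ => ?_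
  rw [norm_mul]
  exact mul_le_mul (ha _ _) (hb _ _) (norm_nonneg _) hr

lemma norm_pow_le {a : Matrix (Fin n) (Fin n) ℚ_[p]}
    (ha : ∀ i j, ‖a i j‖ ≤ (p : ℝ)⁻¹) (m : ℕ) (i j : Fin n) :
    ‖(a ^ m) i j‖ ≤ ((p : ℝ)⁻¹) ^ m := by
  induction m generalizing i j with
  | zero =>
    rw [pow_zero, pow_zero, Matrix.one_apply]
    split_ifs <;> simp
  | succ m ih =>
    rw [pow_succ, pow_succ]
    exact norm_mul_le (by positivity) (by positivity) ih ha i j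

lemma inv_p_lt : (p : ℝ)⁻¹ < 1 := inv_lt_one_of_one_lt₀ (by exact_mod_cast hp.out.one_lt)

lemma summable_bound : Summable (fun m : ℕ => (m : ℝ) * ((p : ℝ)⁻¹) ^ m) := by
  have := summable_pow_mul_geometric_of_norm_lt_one (R := ℝ) 1 (r := (p : ℝ)⁻¹) (by
    rw [Real.norm_of_nonneg (by positivity)]; exact inv_p_lt)
  simpa using this

lemma bound_le_one (m : ℕ) : (m : ℝ) * ((p : ℝ)⁻¹) ^ m ≤ 1 := by
  rw [inv_pow, ← div_eq_mul_inv]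
  refine div_le_one_of_le₀ ?_ (by positivity)
  exact_mod_cast (Nat.lt_pow_self hp.out.one_lt).le

/-- The quotients `(w^{p^k} - 1)/p^k`. -/
noncomputable def X (w : Matrix (Fin n) (Fin n) ℚ_[p]) (k : ℕ) : Matrix (Fin n) (Fin n) ℚ_[p] :=
  ((p : ℚ_[p]) ^ k)⁻¹ • (w ^ (p ^ k) - 1)

lemma X_eq (w : Matrix (Fin n) (Fin n) ℚ_[p]) (k : ℕ) :
    X w k = ∑ m ∈ Finset.range (p ^ k + 1), c p k m • (w - 1) ^ m := by
  have h : w ^ (p ^ k) = ∑ m ∈ Finset.range (p ^ k + 1),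
      ((p ^ k).choose m : ℚ_[p]) • (w - 1) ^ m := by
    conv_lhs => rw [← sub_add_cancel w 1]
    rw [(Commute.one_right (w - 1)).add_pow]
    refine Finset.sum_congr rfl fun m _ => ?_
    rw [one_pow, mul_one, ← nsmul_eq_mul', Nat.cast_smul_eq_nsmul]
  unfold X
  rw [h, Finset.sum_range_succ', Finset.sum_range_succ' (fun m => c p k m • (w - 1) ^ m)]
  simp only [c, Nat.choose_zero_right, Nat.cast_one, pow_zero, one_smul, add_sub_cancel_right,
    if_true, zero_smul, add_zero, Finset.smul_sum]
  refine Finset.sum_congr rfl fun m _ => ?_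
  rw [if_neg (Nat.succ_ne_zero m), smul_smul, div_eq_inv_mul]

lemma norm_term_le {w : Matrix (Fin n) (Fin n) ℚ_[p]}
    (hw : ∀ i j, ‖(w - 1) i j‖ ≤ (p : ℝ)⁻¹) {x : ℚ_[p]} {m : ℕ} (hx : ‖x‖ ≤ m) (i j : Fin n) :
    ‖x * ((w - 1) ^ m) i j‖ ≤ (m : ℝ) * ((p : ℝ)⁻¹) ^ m := by
  rw [norm_mul]
  exact mul_le_mul hx (norm_pow_le hw m i j) (norm_nonneg _) (Nat.cast_nonneg _)

lemma X_int {w : Matrix (Fin n) (Fin n) ℚ_[p]}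
    (hw : ∀ i j, ‖(w - 1) i j‖ ≤ (p : ℝ)⁻¹) (k : ℕ) (i j : Fin n) : ‖X w k i j‖ ≤ 1 := by
  rw [X_eq, Matrix.sum_apply]
  refine IsUltrametricDist.norm_sum_le_of_forall_le_of_nonneg zero_le_one fun m _ => ?_
  exact (norm_term_le hw (norm_c_le k m) i j).trans (bound_le_one m)

lemma X_tsum (w : Matrix (Fin n) (Fin n) ℚ_[p]) (k : ℕ) (i j : Fin n) :
    X w k i j = ∑' m, c p k m * ((w - 1) ^ m) i j := by
  rw [X_eq, Matrix.sum_apply, tsum_eq_sum (s := Finset.range (p ^ k + 1))]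
  · rfl
  · intro m hm
    have hm' : p ^ k < m := by
      rw [Finset.mem_range] at hm; omega
    simp [c, Nat.choose_eq_zero_of_lt hm']

lemma neg_pow_smul (w : Matrix (Fin n) (Fin n) ℚ_[p]) (m : ℕ) :
    (1 - w) ^ m = ((-1 : ℚ_[p]) ^ m) • (w - 1) ^ m := by
  rw [← neg_sub w 1, ← neg_one_smul ℚ_[p] (w - 1), smul_pow]

lemma norm_coef (m : ℕ) : ‖-((-1) ^ m * (m : ℚ_[p])⁻¹)‖ ≤ m := by
  rw [norm_neg, norm_mul, norm_pow, norm_neg, norm_one, one_pow, one_mul]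
  exact norm_inv_nat_le m

lemma matLog_apply {w : Matrix (Fin n) (Fin n) ℚ_[p]}
    (hw : ∀ i j, ‖(w - 1) i j‖ ≤ (p : ℝ)⁻¹) (i j : Fin n) :
    matLog w i j = ∑' m : ℕ, -((-1) ^ m * (m : ℚ_[p])⁻¹) * ((w - 1) ^ m) i j := by
  have hs : ∀ i j, Summable fun m : ℕ => -((-1) ^ m * (m : ℚ_[p])⁻¹) * ((w - 1) ^ m) i j :=
    fun i j => Summable.of_norm_bounded summable_bound
      fun m => norm_term_le hw (norm_coef m) i j
  have H : HasSum (fun m : ℕ => (m : ℚ_[p])⁻¹ • (1 - w) ^ m)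
      (Matrix.of fun i j => -∑' m : ℕ, -((-1) ^ m * (m : ℚ_[p])⁻¹) * ((w - 1) ^ m) i j) := by
    refine Pi.hasSum.2 fun i => Pi.hasSum.2 fun j => ?_
    have e : (fun m : ℕ => ((m : ℚ_[p])⁻¹ • (1 - w) ^ m) i j)
        = fun m : ℕ => -(-((-1) ^ m * (m : ℚ_[p])⁻¹) * ((w - 1) ^ m) i j) := by
      funext m
      rw [neg_pow_smul]
      simp only [Matrix.smul_apply, smul_eq_mul]
      ring
    have h := (hs i j).hasSum.neg
    rw [← e] at h
    exact h
  unfold matLog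
  rw [H.tsum_eq]
  simp

lemma tendsto_X {w : Matrix (Fin n) (Fin n) ℚ_[p]}
    (hw : ∀ i j, ‖(w - 1) i j‖ ≤ (p : ℝ)⁻¹) (i j : Fin n) :
    Tendsto (fun k => X w k i j) atTop (𝓝 (matLog w i j)) := by
  simp_rw [X_tsum, matLog_apply hw]
  refine tendsto_tsum_of_dominated_convergence (summable_bound (p := p))
    (fun m => (tendsto_c m).mul_const _) ?_
  exact Eventually.of_forall fun k m => norm_term_le hw (norm_c_le k m) i j

lemma tendsto_trace_X {w : Matrix (Fin n) (Fin n) ℚ_[p]}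
    (hw : ∀ i j, ‖(w - 1) i j‖ ≤ (p : ℝ)⁻¹) :
    Tendsto (fun k => (X w k).trace) atTop (𝓝 (matLog w).trace) :=
  tendsto_finsetSum _ fun i _ => tendsto_X hw i i

lemma det_approx (A : Matrix (Fin n) (Fin n) ℚ_[p]) (hA : ∀ i j, ‖A i j‖ ≤ 1) (k : ℕ) :
    ∃ e : ℚ_[p], ‖e‖ ≤ 1 ∧ (1 + (p : ℚ_[p]) ^ k • A).det
      = 1 + A.trace * (p : ℚ_[p]) ^ k + e * ((p : ℚ_[p]) ^ k) ^ 2 := by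
  let B : Matrix (Fin n) (Fin n) ℤ_[p] := Matrix.of fun i j => ⟨A i j, hA i j⟩
  have hB : B.map (PadicInt.Coe.ringHom (p := p)) = A := by ext i j; rfl
  have h := congrArg (PadicInt.Coe.ringHom (p := p)) (Matrix.det_one_add_smul ((p : ℤ_[p]) ^ k) B)
  refine ⟨_, PadicInt.norm_le_one (((1 + (Polynomial.X : Polynomial ℤ_[p]) •
    B.map Polynomial.C).det.divX.divX).eval ((p : ℤ_[p]) ^ k)), ?_⟩
  rw [RingHom.map_det] at h
  have hT : PadicInt.Coe.ringHom (p := p) B.trace = A.trace := by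
    rw [← hB]; exact map_sum _ _ _
  rw [map_add (PadicInt.Coe.ringHom (p := p)), map_add (PadicInt.Coe.ringHom (p := p)),
    map_mul, map_mul, hT] at h
  convert h using 2
  · rw [map_add, map_one, ← hB]
    ext i j
    simp [Matrix.smul_apply]
  · simp
  · simp only [map_pow, map_natCast]; rfl

lemma tendsto_det {w : Matrix (Fin n) (Fin n) ℚ_[p]}
    (hw : ∀ i j, ‖(w - 1) i j‖ ≤ (p : ℝ)⁻¹) :
    Tendsto (fun k : ℕ => (w.det ^ (p ^ k) - 1) / (p : ℚ_[p]) ^ k) atTop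
      (𝓝 (matLog w).trace) := by
  choose e he h using fun k => det_approx (X w k) (X_int hw k) k
  have h2 : ∀ k, (w.det ^ (p ^ k) - 1) / (p : ℚ_[p]) ^ k
      = (X w k).trace + e k * (p : ℚ_[p]) ^ k := by
    intro k
    have h0 : (p : ℚ_[p]) ^ k ≠ 0 := pow_ne_zero _ p_ne
    have := h k
    rw [X, smul_inv_smul₀ h0, add_sub_cancel, Matrix.det_pow, ← X] at this
    rw [this, div_eq_iff h0]
    ring
  simp_rw [h2]
  have h3 : Tendsto (fun k => e k * (p : ℚ_[p]) ^ k) atTop (𝓝 0) := by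
    refine squeeze_zero_norm (fun k => ?_) (tendsto_zero_iff_norm_tendsto_zero.1 (tendsto_q (p := p)))
    rw [norm_mul]
    exact mul_le_of_le_one_left (norm_nonneg _) (he k)
  simpa using (tendsto_trace_X hw).add h3

lemma mul_unit {u v : Matrix (Fin n) (Fin n) ℚ_[p]}
    (hu : ∀ i j, ‖(u - 1) i j‖ ≤ (p : ℝ)⁻¹) (hv : ∀ i j, ‖(v - 1) i j‖ ≤ (p : ℝ)⁻¹) (i j : Fin n) :
    ‖(u * v - 1) i j‖ ≤ (p : ℝ)⁻¹ := by
  have h : u * v - 1 = (u - 1) * (v - 1) + (u - 1) + (v - 1) := by noncomm_ring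
  have h1 : ‖((u - 1) * (v - 1)) i j‖ ≤ (p : ℝ)⁻¹ :=
    (norm_mul_le (by positivity) (by positivity) hu hv i j).trans
      (mul_le_of_le_one_left (by positivity) inv_p_lt.le)
  rw [h, Matrix.add_apply, Matrix.add_apply]
  refine (Padic.nonarchimedean _ _).trans (max_le ?_ (hv i j))
  exact (Padic.nonarchimedean _ _).trans (max_le h1 (hu i j))

end TML

/-- Additivity of the trace of the `p`-adic logarithm on `1`-units of matrix algebras
over `ℤ_p` (equation (17) for trivial `Γ`): if all entries of `u − 1` and `v − 1` have
norm `≤ 1/p`, then `trace(log(uv)) = trace(log u) + trace(log v)`, and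
`trace(log u) ∈ ℤ_p`. -/
theorem trace_matLog_one_units {p : ℕ} [Fact p.Prime] {n : ℕ} (hn : 1 ≤ n)
    (u v : Matrix (Fin n) (Fin n) ℚ_[p])
    (hu : ∀ i j, ‖(u - 1) i j‖ ≤ ((p : ℝ))⁻¹)
    (hv : ∀ i j, ‖(v - 1) i j‖ ≤ ((p : ℝ))⁻¹) :
    Matrix.trace (matLog (u * v)) = Matrix.trace (matLog u) + Matrix.trace (matLog v) ∧
    ‖Matrix.trace (matLog u)‖ ≤ 1 := by
  constructor
  · have Hu := TML.tendsto_det hu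
    have Hv := TML.tendsto_det hv
    have H := TML.tendsto_det (TML.mul_unit hu hv)
    refine tendsto_nhds_unique H ?_
    have h := ((Hu.mul Hv).mul (TML.tendsto_q (p := p))).add (Hu.add Hv)
    rw [mul_zero, zero_add] at h
    refine h.congr fun k => ?_
    have h0 : (p : ℚ_[p]) ^ k ≠ 0 := pow_ne_zero _ TML.p_ne
    rw [Matrix.det_mul, mul_pow]
    field_simp
    ring
  · refine le_of_tendsto (TML.tendsto_trace_X hu).norm (Eventually.of_forall fun k => ?_)
    exact IsUltrametricDist.norm_sum_le_of_forall_le_of_nonneg zero_le_one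
      fun i _ => TML.X_int hu k i i
end
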